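/- Let (p,p') be a pair of coprime positive integers with p ≥ 2, set a = p'/p, and let r, s, m be integers with 0 ≤ m ≤ 2p'−1. Then for all τ ∈ ℍ, ϑ_{1,1}( (p'−1/2)τ/(2pp') + (−rp'+sp−pm+pp')/(2pp'); τ/(2pp') ) − e^{2πir(a−1/(2p))} ϑ_{1,1}( (p'−1/2)τ/(2pp') + (rp'+sp−pm+pp')/(2pp'); τ/(2pp') ) = 2 e^{πi(ar−s+m)} e^{πi(−rp'+sp−pm)/(2pp')} e^{−2πiτ(2p'−1)²/(16pp')} Σ_{L=p'}^{2pp'+p'−1} e^{πiL(s−m)/p'} sin(πrL/p) Σ_{n∈ℤ} e^{2πiτ pp'(n+L/(2pp'))²}. -/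

import Mathlib

open Complex
open scoped Real

noncomputable section

/-- `e2 x = exp(2πi x)`. -/
def e2 (x : ℂ) : ℂ := Complex.exp (2 * (π : ℂ) * Complex.I * x)

/-- Jacobi theta with characteristics ε, ε' ∈ {0,1}. -/
def theta (ε ε' : ℕ) (u τ : ℂ) : ℂ :=
  e2 (u * ε / 2) * e2 (τ * ε / 8) *
    ∏' n : ℕ,
      ((1 - e2 (τ * (n + 1))) *
        (1 + (-1 : ℂ) ^ ε' * e2 u * e2 (τ * ((n + 1 : ℂ) - (1 - (ε : ℂ)) / 2))) *
        (1 + (-1 : ℂ) ^ ε' * e2 (-u) * e2 (τ * ((n + 1 : ℂ) - (1 + (ε : ℂ)) / 2))))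

section

open Filter Topology

/-- The finite `q`-Pochhammer symbol `(q; q)_n`. -/
def qPoch (q : ℂ) (n : ℕ) : ℂ := ∏ i ∈ Finset.range n, (1 - q ^ (i + 1))

/-- The reciprocal of `(q; q)_n`, extended by zero to negative `n`. -/
def invQPoch (q : ℂ) (n : ℤ) : ℂ := if 0 ≤ n then (qPoch q n.toNat)⁻¹ else 0

lemma one_sub_pow_succ_ne_zero {q : ℂ} (hq : ‖q‖ < 1) (n : ℕ) : 1 - q ^ (n + 1) ≠ 0 := by
  intro h
  have h1 : ‖q ^ (n + 1)‖ < 1 := by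
    rw [norm_pow]
    exact pow_lt_one₀ (norm_nonneg q) hq n.succ_ne_zero
  rw [← sub_eq_zero.mp h, norm_one] at h1
  exact lt_irrefl _ h1

lemma qPoch_ne_zero {q : ℂ} (hq : ‖q‖ < 1) (n : ℕ) : qPoch q n ≠ 0 :=
  Finset.prod_ne_zero_iff.mpr fun i _ ↦ one_sub_pow_succ_ne_zero hq i

lemma qPoch_succ (q : ℂ) (n : ℕ) : qPoch q (n + 1) = qPoch q n * (1 - q ^ (n + 1)) :=
  Finset.prod_range_succ _ _

lemma invQPoch_sub_one {q : ℂ} (hq : ‖q‖ < 1) (n : ℤ) :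
    invQPoch q (n - 1) = (1 - q ^ n) * invQPoch q n := by
  rcases lt_trichotomy n 0 with h | rfl | h
  · simp [invQPoch, show ¬ (1 ≤ n) by omega, show ¬ (0 ≤ n) by omega]
  · simp [invQPoch]
  · obtain ⟨k, rfl⟩ : ∃ k : ℕ, n = k + 1 := ⟨(n - 1).toNat, by omega⟩
    have h1 : ((k : ℤ) + 1).toNat = k + 1 := by omega
    have h2 := one_sub_pow_succ_ne_zero hq k
    have h3 := qPoch_ne_zero hq k
    have h4 : q ^ ((k : ℤ) + 1) = q ^ (k + 1) := by exact_mod_cast zpow_natCast q (k + 1)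
    simp only [invQPoch, add_sub_cancel_right, h1, h4, qPoch_succ, Int.toNat_natCast]
    rw [if_pos (by omega), if_pos (by omega)]
    field_simp

lemma summable_norm_pow {q : ℂ} (hq : ‖q‖ < 1) : Summable fun n : ℕ ↦ ‖q ^ n‖ := by
  simpa only [norm_pow] using summable_geometric_of_lt_one (norm_nonneg q) hq

lemma multipliable_one_sub_mul_pow {q : ℂ} (hq : ‖q‖ < 1) (c : ℂ) :
    Multipliable fun n : ℕ ↦ 1 - c * q ^ n := by
  simp only [sub_eq_add_neg]
  refine multipliable_one_add_of_summable ?_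
  simpa only [norm_neg, norm_mul] using (summable_norm_pow hq).mul_left ‖c‖

lemma exists_tendsto_qPoch {q : ℂ} (hq : ‖q‖ < 1) :
    ∃ φ : ℂ, φ ≠ 0 ∧ Tendsto (qPoch q) atTop (𝓝 φ) := by
  have h : Multipliable fun n : ℕ ↦ 1 - q ^ (n + 1) := by
    simpa only [pow_succ'] using multipliable_one_sub_mul_pow hq q
  refine ⟨∏' n : ℕ, (1 - q ^ (n + 1)), ?_, h.tendsto_prod_tprod_nat⟩
  simp only [sub_eq_add_neg]
  refine tprod_one_add_ne_zero_of_summable (fun i ↦ ?_) ?_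
  · simpa only [← sub_eq_add_neg] using one_sub_pow_succ_ne_zero hq i
  · simpa only [norm_neg] using (summable_nat_add_iff 1).mpr (summable_norm_pow hq)

/-- The finite form of the Jacobi triple product identity. -/
lemma hasSum_finite_triple_product {q z : ℂ} (hq : ‖q‖ < 1) (hq0 : q ≠ 0) (hz : z ≠ 0)
    {w : ℤ → ℂ} (w_zero : w 0 = 1) (w_succ : ∀ k, w (k + 1) = -(z * q ^ (k + 1)) * w k) (N : ℕ) :
    HasSum (fun k : ℤ ↦ w k * (qPoch q (2 * N) * invQPoch q (N + k) * invQPoch q (N - k)))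
      (∏ n ∈ Finset.range N, ((1 - z * q ^ (n + 1)) * (1 - z⁻¹ * q ^ n))) := by
  induction N with
  | zero =>
    have h := hasSum_single (f := fun k : ℤ ↦ w k * (qPoch q (2 * 0) *
      invQPoch q ((0 : ℕ) + k) * invQPoch q ((0 : ℕ) - k))) 0 (fun k hk ↦ by
        rcases lt_or_gt_of_ne hk with h | h
        · simp [invQPoch, show ¬ (0 ≤ k) by omega]
        · simp [invQPoch, show ¬ (k ≤ 0) by omega])
    simpa [invQPoch, qPoch, w_zero] using h
  | succ N ih =>
    have h1 := (Equiv.addRight (-1 : ℤ)).hasSum_iff.mpr ih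
    have h2 := (Equiv.addRight (1 : ℤ)).hasSum_iff.mpr ih
    rw [Finset.prod_range_succ]
    have h3 := ((ih.mul_left (1 + q ^ (2 * N + 1))).sub (h1.mul_left (z * q ^ (N + 1)))).sub
      (h2.mul_left (z⁻¹ * q ^ N))
    refine (congrArg₂ (fun f a ↦ HasSum f a) (funext fun k ↦ Eq.symm ?_) ?_).mp h3
    · have ha : invQPoch q ((N : ℤ) + k) = _ :=
        (congrArg _ (by ring)).trans (invQPoch_sub_one hq ((N : ℤ) + 1 + k))
      have ha' : invQPoch q ((N : ℤ) + (k + -1)) = _ :=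
        (congrArg _ (by ring)).trans (invQPoch_sub_one hq ((N : ℤ) + k))
      have hb : invQPoch q ((N : ℤ) - k) = _ :=
        (congrArg _ (by ring)).trans (invQPoch_sub_one hq ((N : ℤ) + 1 - k))
      have hb' : invQPoch q ((N : ℤ) - (k + 1)) = _ :=
        (congrArg _ (by ring)).trans (invQPoch_sub_one hq ((N : ℤ) - k))
      have ha'' : invQPoch q ((N : ℤ) + (k + 1)) = invQPoch q ((N : ℤ) + 1 + k) :=
        congrArg _ (by ring)
      have hb'' : invQPoch q ((N : ℤ) - (k + -1)) = invQPoch q ((N : ℤ) + 1 - k) :=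
        congrArg _ (by ring)
      have hw : w k = -(z * q ^ k) * w (k + -1) := by simpa using w_succ (k + -1)
      have hX : q ^ k ≠ 0 := zpow_ne_zero k hq0
      simp only [Function.comp_apply, Equiv.coe_addRight]
      rw [ha', hb', ha'', hb'', ha, hb, w_succ k, hw, show 2 * (N + 1) = 2 * N + 1 + 1 by ring,
        qPoch_succ, qPoch_succ]
      push_cast
      simp only [zpow_add₀ hq0, zpow_sub₀ hq0, zpow_natCast, zpow_one, pow_succ, pow_mul']
      field_simp
      ring
    · field_simp
      ring

/-- The Jacobi triple product identity, with the terms `w k = (-z) ^ k * q ^ (k * (k + 1) / 2)`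
of the series given through their recurrence relation. -/
theorem tprod_triple_product {q z : ℂ} (hq : ‖q‖ < 1) (hq0 : q ≠ 0) (hz : z ≠ 0)
    {w : ℤ → ℂ} (w_zero : w 0 = 1) (w_succ : ∀ k, w (k + 1) = -(z * q ^ (k + 1)) * w k)
    (w_summable : Summable w) :
    ∏' n : ℕ, ((1 - q ^ (n + 1)) * (1 - z * q ^ (n + 1)) * (1 - z⁻¹ * q ^ n)) = ∑' k, w k := by
  have hmul : Multipliable fun n : ℕ ↦
      (1 - q ^ (n + 1)) * (1 - z * q ^ (n + 1)) * (1 - z⁻¹ * q ^ n) := by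
    refine (Multipliable.mul ?_ ?_).mul (multipliable_one_sub_mul_pow hq z⁻¹)
    · simpa only [pow_succ'] using multipliable_one_sub_mul_pow hq q
    · simpa only [pow_succ', mul_assoc] using multipliable_one_sub_mul_pow hq (z * q)
  refine tendsto_nhds_unique hmul.tendsto_prod_tprod_nat ?_
  have hpart (N : ℕ) : ∏ n ∈ Finset.range N,
      ((1 - q ^ (n + 1)) * (1 - z * q ^ (n + 1)) * (1 - z⁻¹ * q ^ n)) =
      ∑' k : ℤ, qPoch q N * (w k * (qPoch q (2 * N) * invQPoch q (N + k) * invQPoch q (N - k))) := by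
    rw [((hasSum_finite_triple_product hq hq0 hz w_zero w_succ N).mul_left _).tsum_eq, qPoch,
      ← Finset.prod_mul_distrib]
    simp only [mul_assoc]
  simp only [hpart]
  obtain ⟨φ, hφ, hlim⟩ := exists_tendsto_qPoch hq
  have hinv : Tendsto (fun n ↦ (qPoch q n)⁻¹) atTop (𝓝 φ⁻¹) := hlim.inv₀ hφ
  obtain ⟨C, hC⟩ := hlim.norm.bddAbove_range
  obtain ⟨D, hD⟩ := hinv.norm.bddAbove_range
  have hC' (n : ℕ) : ‖qPoch q n‖ ≤ C := hC ⟨n, rfl⟩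
  have hD0 : 0 ≤ D := (norm_nonneg _).trans (hD ⟨0, rfl⟩)
  have hD' (n : ℤ) : ‖invQPoch q n‖ ≤ D := by
    unfold invQPoch
    split_ifs
    · exact hD ⟨n.toNat, rfl⟩
    · simpa using hD0
  have hC0 : 0 ≤ C := (norm_nonneg _).trans (hC' 0)
  have htoNat : Tendsto Int.toNat atTop atTop := tendsto_atTop.mpr fun b ↦
    (eventually_ge_atTop (b : ℤ)).mono fun n hn ↦ by omega
  have hinvZ : Tendsto (invQPoch q) atTop (𝓝 φ⁻¹) := by
    refine (hinv.comp htoNat).congr' ?_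
    filter_upwards [eventually_ge_atTop 0] with n hn
    simp [invQPoch, hn]
  refine tendsto_tsum_of_dominated_convergence
    (bound := fun k ↦ C * (‖w k‖ * (C * D * D))) ((w_summable.norm.mul_right _).mul_left _) ?_ ?_
  · intro k
    have h2N : Tendsto (fun N : ℕ ↦ qPoch q (2 * N)) atTop (𝓝 φ) :=
      hlim.comp (tendsto_id.const_mul_atTop' two_pos)
    have hp : Tendsto (fun N : ℕ ↦ invQPoch q (N + k)) atTop (𝓝 φ⁻¹) :=
      hinvZ.comp (tendsto_atTop_add_const_right _ k tendsto_natCast_atTop_atTop)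
    have hm : Tendsto (fun N : ℕ ↦ invQPoch q (N - k)) atTop (𝓝 φ⁻¹) :=
      hinvZ.comp (tendsto_atTop_add_const_right _ (-k) tendsto_natCast_atTop_atTop)
    convert hlim.mul (((h2N.mul hp).mul hm).const_mul (w k)) using 2
    field_simp
  · refine Eventually.of_forall fun N k ↦ ?_
    simp only [norm_mul]
    gcongr
    exacts [hC' _, hC' _, hD' _, hD' _]

lemma e2_add (x y : ℂ) : e2 (x + y) = e2 x * e2 y := by
  rw [e2, e2, e2, ← Complex.exp_add, mul_add]

lemma e2_neg (x : ℂ) : e2 (-x) = (e2 x)⁻¹ := by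
  rw [e2, e2, ← Complex.exp_neg, mul_neg]

lemma e2_mul_intCast (x : ℂ) (n : ℤ) : e2 (x * n) = e2 x ^ n := by
  rw [e2, e2, ← Complex.exp_int_mul]
  ring_nf

lemma e2_mul_natCast (x : ℂ) (n : ℕ) : e2 (x * n) = e2 x ^ n := by
  exact_mod_cast e2_mul_intCast x n

lemma norm_e2_lt_one {τ : ℂ} (hτ : 0 < τ.im) : ‖e2 τ‖ < 1 := by
  rw [e2, Complex.norm_exp, Real.exp_lt_one_iff]
  simp
  positivity

/-- The series expansion of `ϑ₁₁`. -/
theorem hasSum_theta_one_one (u : ℂ) {τ : ℂ} (hτ : 0 < τ.im) :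
    HasSum (fun k : ℤ ↦ e2 (k / 2 + (k + 1 / 2) * u + (k + 1 / 2) ^ 2 / 2 * τ)) (theta 1 1 u τ) := by
  set w : ℤ → ℂ := fun k ↦ jacobiTheta₂_term k (u + 1 / 2 + τ / 2) τ with hw
  have hw' (k : ℤ) : w k = e2 (k * (u + 1 / 2 + τ / 2) + k ^ 2 / 2 * τ) := by
    simp only [hw, jacobiTheta₂_term, e2]
    ring_nf
  have hws : Summable w := (summable_jacobiTheta₂_term_iff _ _).mpr hτ
  have hhalf : e2 (1 / 2) = -1 := by
    rw [e2, ← Complex.exp_pi_mul_I]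
    ring_nf
  have w_succ (k : ℤ) : w (k + 1) = -(e2 u * e2 τ ^ (k + 1)) * w k := by
    rw [← e2_mul_intCast, hw', hw', ← neg_one_mul, ← hhalf, ← e2_add, ← e2_add, ← e2_add]
    push_cast
    ring_nf
  have h := tprod_triple_product (norm_e2_lt_one hτ) (Complex.exp_ne_zero _)
    (show e2 u ≠ 0 from Complex.exp_ne_zero _) (by simp [hw', e2]) w_succ hws
  have htheta : theta 1 1 u τ = e2 (u / 2 + τ / 8) * ∑' k, w k := by
    rw [← h, theta, e2_add]
    congr 1
    · simp
    · refine tprod_congr fun n ↦ ?_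
      rw [← e2_neg, ← e2_mul_natCast, ← e2_mul_natCast]
      push_cast
      ring_nf
  rw [htheta]
  refine (congrArg (fun f ↦ HasSum f _) (funext fun k ↦ Eq.symm ?_)).mp
    (hws.hasSum.mul_left (e2 (u / 2 + τ / 8)))
  rw [hw', ← e2_add]
  ring_nf

/-- The series of `ϑ₁₁` at the points `((p' - 1/2) τ + B + p p') / (2 p p')`, after completing
the square. -/
lemma hasSum_theta_complete_square {p p' : ℤ} (hM : 0 < 2 * p * p') (B : ℤ) {τ : ℂ}
    (hτ : 0 < τ.im) :
    HasSum (fun L : ℤ ↦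
        Complex.I * Complex.exp (-2 * (π : ℂ) * Complex.I * τ * (2 * (p' : ℂ) - 1) ^ 2 /
          (16 * p * p')) *
        Complex.exp (2 * (π : ℂ) * Complex.I * (L - p' + 1 / 2) * (B / (2 * p * p'))) *
        Complex.exp ((π : ℂ) * Complex.I * τ * (L : ℂ) ^ 2 / (2 * p * p')))
      (theta 1 1 (((p' : ℂ) - 1 / 2) * τ / (2 * p * p') + ((B + p * p' : ℤ) : ℂ) / (2 * p * p'))
        (τ / (2 * p * p'))) := by
  have hP : (p : ℂ) ≠ 0 := by
    rintro h
    simp [Int.cast_eq_zero.mp h] at hM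
  have hP' : (p' : ℂ) ≠ 0 := by
    rintro h
    simp [Int.cast_eq_zero.mp h] at hM
  have hτM : 0 < (τ / (2 * p * p')).im := by
    have h : (τ / (2 * p * p')).im = τ.im / ((2 * p * p' : ℤ) : ℝ) := by
      rw [← Complex.div_ofReal_im]
      push_cast
      rfl
    rw [h]
    have : (0 : ℝ) < ((2 * p * p' : ℤ) : ℝ) := by exact_mod_cast hM
    positivity
  refine (congrArg (fun f ↦ HasSum f _) (funext fun L ↦ ?_)).mp
    ((Equiv.subRight p').hasSum_iff.mpr (hasSum_theta_one_one _ hτM))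
  have hI (x : ℂ) : Complex.I * Complex.exp x = Complex.exp ((π : ℂ) / 2 * Complex.I + x) := by
    rw [Complex.exp_add, Complex.exp_pi_div_two_mul_I]
  simp only [Function.comp_apply, Equiv.subRight_apply, e2]
  rw [hI, ← Complex.exp_add, ← Complex.exp_add, Complex.exp_eq_exp_iff_exists_int]
  refine ⟨L - p', ?_⟩
  push_cast
  field_simp
  ring

/-- Splitting a sum over `ℤ` into residue classes modulo `M`, represented in `[a, a + M)`. -/
lemma tsum_eq_sum_Icc_tsum {f : ℤ → ℂ} (hf : Summable f) (a : ℤ) {M : ℤ} (hM : 0 < M) :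
    ∑' k, f k = ∑ L ∈ Finset.Icc a (a + M - 1), ∑' n : ℤ, f (L + M * n) := by
  let g : Finset.Icc a (a + M - 1) × ℤ → ℤ := fun x ↦ x.1 + M * x.2
  have hg : Function.Bijective g := by
    constructor
    · rintro ⟨⟨L, hL⟩, n⟩ ⟨⟨L', hL'⟩, n'⟩ h
      rw [Finset.mem_Icc] at hL hL'
      simp only [g] at h
      have hn : n = n' := by
        rcases lt_trichotomy n n' with hlt | heq | hlt
        · nlinarith
        · exact heq
        · nlinarith
      subst hn
      simpa using h
    · intro k
      refine ⟨⟨⟨a + (k - a) % M, ?_⟩, (k - a) / M⟩, ?_⟩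
      · have h1 := Int.emod_nonneg (k - a) hM.ne'
        have h2 := Int.emod_lt_of_pos (k - a) hM
        rw [Finset.mem_Icc]
        omega
      · have := Int.emod_add_mul_ediv (k - a) M
        simp only [g]
        linarith
  have hs : Summable fun x ↦ f (g x) := (Equiv.ofBijective g hg).summable_iff.mpr hf
  rw [← (Equiv.ofBijective g hg).tsum_eq f]
  change ∑' x, f (g x) = _
  rw [hs.tsum_prod, tsum_fintype,
    ← Finset.sum_coe_sort (Finset.Icc a (a + M - 1)) fun L ↦ ∑' n : ℤ, f (L + M * n)]

end

/-- The theta-part of the continuous contribution of the atypical S-transformation. -/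
theorem theta_part_identity (p p' : ℤ) (hp : 2 ≤ p) (hp' : 1 ≤ p')
    (hco : IsCoprime p p') (r s m : ℤ) (hm0 : 0 ≤ m) (hm1 : m ≤ 2 * p' - 1)
    (τ : ℂ) (hτ : 0 < τ.im) :
    theta 1 1 (((p' : ℂ) - 1 / 2) * τ / (2 * p * p') +
        ((-r * p' + s * p - p * m + p * p' : ℤ) : ℂ) / (2 * p * p')) (τ / (2 * p * p')) -
      Complex.exp (2 * (π : ℂ) * Complex.I * r * ((p' : ℂ) / p - 1 / (2 * p))) *
        theta 1 1 (((p' : ℂ) - 1 / 2) * τ / (2 * p * p') +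
          ((r * p' + s * p - p * m + p * p' : ℤ) : ℂ) / (2 * p * p')) (τ / (2 * p * p')) =
      2 * Complex.exp ((π : ℂ) * Complex.I * (((p' : ℂ) / p) * r - s + m)) *
        Complex.exp ((π : ℂ) * Complex.I * ((-r * p' + s * p - p * m : ℤ) : ℂ) / (2 * p * p')) *
        Complex.exp (-2 * (π : ℂ) * Complex.I * τ * (2 * (p' : ℂ) - 1) ^ 2 / (16 * p * p')) *
        ∑ L ∈ Finset.Icc p' (2 * p * p' + p' - 1),
          Complex.exp ((π : ℂ) * Complex.I * (L : ℂ) * ((s : ℂ) - m) / p') *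
            (Real.sin (π * r * L / p) : ℂ) *
            ∑' n : ℤ, Complex.exp (2 * (π : ℂ) * Complex.I * τ * ((p * p' : ℤ) : ℂ) *
              ((n : ℂ) + (L : ℂ) / (2 * p * p')) ^ 2) := by
  have hP : (p : ℂ) ≠ 0 := by exact_mod_cast (by omega : p ≠ 0)
  have hP' : (p' : ℂ) ≠ 0 := by exact_mod_cast (by omega : p' ≠ 0)
  have hM : 0 < 2 * p * p' := by positivity
  set F : ℤ → ℂ := fun L ↦ Complex.exp ((π : ℂ) * Complex.I * (L : ℂ) * ((s : ℂ) - m) / p') *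
    (Real.sin (π * r * L / p) : ℂ) *
      Complex.exp ((π : ℂ) * Complex.I * τ * (L : ℂ) ^ 2 / (2 * p * p')) with hF
  set K : ℂ := 2 * Complex.exp ((π : ℂ) * Complex.I * (((p' : ℂ) / p) * r - s + m)) *
    Complex.exp ((π : ℂ) * Complex.I * ((-r * p' + s * p - p * m : ℤ) : ℂ) / (2 * p * p')) *
    Complex.exp (-2 * (π : ℂ) * Complex.I * τ * (2 * (p' : ℂ) - 1) ^ 2 / (16 * p * p')) with hK
  have hK0 : K ≠ 0 := by simp [hK, Complex.exp_ne_zero]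
  have hsum : HasSum (fun L ↦ K * F L) _ :=
    (congrArg (fun f ↦ HasSum f _) (funext fun L ↦ ?_)).mp
      ((hasSum_theta_complete_square hM (-r * p' + s * p - p * m) hτ).sub
        ((hasSum_theta_complete_square hM (r * p' + s * p - p * m) hτ).mul_left
          (Complex.exp (2 * (π : ℂ) * Complex.I * r * ((p' : ℂ) / p - 1 / (2 * p))))))
  · have hFs : Summable F := (summable_mul_left_iff hK0).mp hsum.summable
    rw [← hsum.tsum_eq, tsum_mul_left, tsum_eq_sum_Icc_tsum hFs p' hM,
      show p' + 2 * p * p' - 1 = 2 * p * p' + p' - 1 by ring]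
    refine congrArg _ (Finset.sum_congr rfl fun L _ ↦ ?_)
    rw [← tsum_mul_left]
    refine tsum_congr fun n ↦ ?_
    simp only [hF]
    congr 1
    · congr 1
      · rw [Complex.exp_eq_exp_iff_exists_int]
        refine ⟨p * n * (s - m), ?_⟩
        push_cast
        field_simp
      · rw [← Real.sin_add_int_mul_two_pi (π * r * L / p) (r * p' * n)]
        have : (p : ℝ) ≠ 0 := by exact_mod_cast (by omega : p ≠ 0)
        congr 2
        push_cast
        field_simp
    · congr 1
      push_cast
      field_simp
      ring
  · simp only [hK, hF, Complex.ofReal_sin, Complex.sin]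
    have h1 : Complex.exp (2 * (π : ℂ) * Complex.I * (L - p' + 1 / 2) *
        ((-r * p' + s * p - p * m : ℤ) / (2 * p * p'))) =
        Complex.exp ((π : ℂ) * Complex.I * (((p' : ℂ) / p) * r - s + m)) *
        Complex.exp ((π : ℂ) * Complex.I * ((-r * p' + s * p - p * m : ℤ) : ℂ) / (2 * p * p')) *
        Complex.exp ((π : ℂ) * Complex.I * (L : ℂ) * ((s : ℂ) - m) / p') *
        Complex.exp (-((π * r * L / p : ℝ) : ℂ) * Complex.I) := by
      simp only [← Complex.exp_add]
      congr 1
      push_cast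
      field_simp
      ring
    have h2 : Complex.exp (2 * (π : ℂ) * Complex.I * r * ((p' : ℂ) / p - 1 / (2 * p))) *
        Complex.exp (2 * (π : ℂ) * Complex.I * (L - p' + 1 / 2) *
        ((r * p' + s * p - p * m : ℤ) / (2 * p * p'))) =
        Complex.exp ((π : ℂ) * Complex.I * (((p' : ℂ) / p) * r - s + m)) *
        Complex.exp ((π : ℂ) * Complex.I * ((-r * p' + s * p - p * m : ℤ) : ℂ) / (2 * p * p')) *
        Complex.exp ((π : ℂ) * Complex.I * (L : ℂ) * ((s : ℂ) - m) / p') *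
        Complex.exp (((π * r * L / p : ℝ) : ℂ) * Complex.I) := by
      simp only [← Complex.exp_add]
      congr 1
      push_cast
      field_simp
      ring
    linear_combination
      Complex.I * Complex.exp (-2 * (π : ℂ) * Complex.I * τ * (2 * (p' : ℂ) - 1) ^ 2 /
        (16 * p * p')) * Complex.exp ((π : ℂ) * Complex.I * τ * (L : ℂ) ^ 2 / (2 * p * p')) *
        (h1 - h2)

end
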